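/- arXiv:1612.09427 — 3 statements merged into one kernel-verified Lean document; each statement's English description precedes it below -/
import Mathlib

section
/- Let 𝒯 be the d-regular tree with d ≥ 3 and let G ≤ Aut(𝒯) be a closed subgroup. The following are equivalent: (i) the vertex stabilizer G_x acts transitively on ∂𝒯 for every vertex x of 𝒯; (ii) G is non-compact and there exists a vertex x such that G_x acts transitively on ∂𝒯; (iii) G is non-compact and acts transitively on ∂𝒯; (iv) G acts 2-transitively on ∂𝒯 (transitively on ordered pairs of distinct ends). -/
open Filter Topology
open scoped InnerProductSpace

namespace TreeHM

variable {V : Type}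

/-! ### The automorphism group of a graph, with the topology of pointwise convergence -/

noncomputable instance autTopologicalSpace (T : SimpleGraph V) : TopologicalSpace (T ≃g T) :=
  letI : TopologicalSpace V := ⊥
  TopologicalSpace.induced (fun (g : T ≃g T) (x : V) => g x) inferInstance

/-- A graph automorphism preserves the combinatorial distance. -/
theorem iso_dist_le (T : SimpleGraph V) (g : T ≃g T) (u v : V) :
    T.dist (g u) (g v) ≤ T.dist u v := by
  by_cases h : T.Reachable u v
  · obtain ⟨p, hp⟩ := h.exists_walk_length_eq_dist
    calc T.dist (g u) (g v) ≤ (p.map g.toHom).length := SimpleGraph.dist_le _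
      _ = p.length := SimpleGraph.Walk.length_map _ _
      _ = T.dist u v := hp
  · rw [SimpleGraph.dist_eq_zero_of_not_reachable h,
      SimpleGraph.dist_eq_zero_of_not_reachable]
    intro hr
    have := hr.map g.symm.toHom
    exact h (by simpa using this)

theorem iso_dist_eq (T : SimpleGraph V) (g : T ≃g T) (u v : V) :
    T.dist (g u) (g v) = T.dist u v := by
  refine le_antisymm (iso_dist_le T g u v) ?_
  have := iso_dist_le T g⁻¹ (g u) (g v)
  simpa using this

/-- The tree `T` is locally finite. -/
def LocFin (T : SimpleGraph V) : Prop := ∀ x : V, (T.neighborSet x).Finite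

/-- The graph `T` is `d`-regular: every vertex has exactly `d` neighbours. -/
def Regular (T : SimpleGraph V) (d : ℕ) : Prop := ∀ x : V, (T.neighborSet x).ncard = d

/-! ### Geodesic rays and ends -/

/-- A geodesic ray in a graph; for a tree, the ends `∂T` are the equivalence classes of
geodesic rays under the relation `RayEquiv` of sharing a common subray.  Throughout, an end
`ξ ∈ ∂T` is represented by a geodesic ray, and equality of ends is `RayEquiv`. -/
structure GeodRay (T : SimpleGraph V) : Type where
  seq : ℕ → V
  adj : ∀ n, T.Adj (seq n) (seq (n + 1))
  geodesic : ∀ m n, T.dist (seq m) (seq n) = Nat.dist m n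

/-- A bi-infinite geodesic line in a graph. -/
structure GeodLine (T : SimpleGraph V) : Type where
  seq : ℤ → V
  adj : ∀ n, T.Adj (seq n) (seq (n + 1))
  geodesic : ∀ m n, T.dist (seq m) (seq n) = (m - n).natAbs

/-- Two geodesic rays are equivalent (define the same end) iff they share a common subray. -/
def RayEquiv (T : SimpleGraph V) (r s : GeodRay T) : Prop :=
  ∃ k l : ℕ, ∀ n : ℕ, r.seq (k + n) = s.seq (l + n)

/-- The image of a geodesic ray under an automorphism. -/
def mapRay (T : SimpleGraph V) (g : T ≃g T) (r : GeodRay T) : GeodRay T where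
  seq := fun n => g (r.seq n)
  adj := fun n => g.map_adj_iff.mpr (r.adj n)
  geodesic := fun m n => by rw [iso_dist_eq]; exact r.geodesic m n

/-- `g` fixes the end represented by the ray `r`. -/
def FixesEnd (T : SimpleGraph V) (g : T ≃g T) (r : GeodRay T) : Prop :=
  RayEquiv T (mapRay T g r) r

/-- A sequence of vertices converges to the end represented by the geodesic ray `r`:
for every `m`, the vertex `r.seq m` eventually lies on the geodesic from `r.seq 0` to `y n`,
i.e. the common initial segment of `[r.seq 0, y n]` and the ray tends to infinity. -/
def TendstoEnd (T : SimpleGraph V) (y : ℕ → V) (r : GeodRay T) : Prop :=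
  ∀ m : ℕ, ∀ᶠ n in atTop, T.dist (r.seq 0) (y n) = m + T.dist (r.seq m) (y n)

/-! ### Translation length and hyperbolic automorphisms -/

/-- The translation length `|g| = min_x dist(x, g x)` of an automorphism. -/
noncomputable def transLen (T : SimpleGraph V) (g : T ≃g T) : ℕ :=
  sInf (Set.range fun x : V => T.dist x (g x))

/-- `g` is hyperbolic iff its translation length is positive. -/
def IsHyperbolic (T : SimpleGraph V) (g : T ≃g T) : Prop := 0 < transLen T g

/-- The set `Min(g)` of vertices realizing the translation length; for a hyperbolic
automorphism of a tree this is its translation axis. -/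
def MinSet (T : SimpleGraph V) (g : T ≃g T) : Set V :=
  {x : V | T.dist x (g x) = transLen T g}

/-- The ray `r` (based at the axis) represents the attracting end of `a`:
the orbit `a^n x` converges to this end. -/
def IsAttractingEnd (T : SimpleGraph V) (a : T ≃g T) (r : GeodRay T) : Prop :=
  TendstoEnd T (fun n : ℕ => (a ^ n) (r.seq 0)) r

/-! ### Half-trees and Tits' independence property -/

/-- The half-tree determined by an oriented edge `(a, b)` of a tree:  all vertices `y`
lying on the side of `a`, i.e. whose geodesic to `b` passes through `a`. -/
def EdgeSide (T : SimpleGraph V) (a b : V) : Set V :=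
  {y : V | T.dist b y = T.dist a y + 1}

/-- The half-tree emanating from the base vertex `r.seq 0` of a ray `r` and containing the
end of `r` in its boundary. -/
def RaySide (T : SimpleGraph V) (r : GeodRay T) : Set V :=
  {y : V | y = r.seq 0 ∨ T.dist (r.seq 0) y = 1 + T.dist (r.seq 1) y}

/-- Tits' independence property for a subgroup `G ≤ Aut(T)`:  for every edge `e = (a, b)`,
the pointwise stabilizer `G_e` decomposes as `G_{T₁} · G_{T₂}`, where `T₁, T₂` are the two
half-trees emanating from `e` and `G_{Tᵢ}` is the pointwise stabilizer of `Tᵢ`. -/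
def TitsIndep (T : SimpleGraph V) (G : Subgroup (T ≃g T)) : Prop :=
  ∀ a b : V, T.Adj a b → ∀ g ∈ G, g a = a → g b = b →
    ∃ g₁ ∈ G, ∃ g₂ ∈ G, g = g₁ * g₂ ∧
      (∀ y ∈ EdgeSide T a b, g₁ y = y) ∧ (∀ y ∈ EdgeSide T b a, g₂ y = y)

/-! ### Stabilizers and contraction groups -/

/-- The subgroup `G_ξ⁰ = {g ∈ G : g ξ = ξ and g fixes some vertex}`, as a subset of `G`. -/
def EndStab0 (T : SimpleGraph V) (G : Subgroup (T ≃g T)) (ξ : GeodRay T) : Set G :=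
  {g : G | FixesEnd T (g : T ≃g T) ξ ∧ ∃ x : V, (g : T ≃g T) x = x}

/-- The contraction group `U⁺_α` of a sequence `α` in `G`. -/
def ContrSeq {G : Type} [Group G] [TopologicalSpace G] (α : ℕ → G) : Set G :=
  {g : G | Tendsto (fun n : ℕ => (α n)⁻¹ * g * α n) atTop (𝓝 1)}

/-- The contraction group `U⁺_a = {g : a⁻ⁿ g aⁿ → 1}` of an element `a` of `G`. -/
def Upos {G : Type} [Group G] [TopologicalSpace G] (a : G) : Set G :=
  ContrSeq (fun n : ℕ => a ^ n)

/-- The contraction group `U⁻_a = {g : aⁿ g a⁻ⁿ → 1}` of an element `a` of `G`. -/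
def Uneg {G : Type} [Group G] [TopologicalSpace G] (a : G) : Set G :=
  ContrSeq (fun n : ℕ => (a ^ n)⁻¹)

/-! ### Unitary representations and the Howe–Moore property -/

/-- A (strongly continuous) unitary representation of a topological group `G` on a complex
inner product space `H`. -/
structure UnitaryRep (G : Type) [Group G] [TopologicalSpace G]
    (H : Type) [NormedAddCommGroup H] [InnerProductSpace ℂ H] where
  ρ : G →* (H ≃ₗᵢ[ℂ] H)
  strong_continuity : ∀ v : H, Continuous fun g : G => ρ g v

/-- The representation `π` has no nonzero `G`-invariant vector. -/
def NoInvariantVectors {G : Type} [Group G] [TopologicalSpace G]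
    {H : Type} [NormedAddCommGroup H] [InnerProductSpace ℂ H]
    (π : UnitaryRep G H) : Prop :=
  ∀ v : H, (∀ g : G, π.ρ g v = v) → v = 0

/-- The Howe–Moore property: every unitary representation without nonzero invariant vectors
has all its matrix coefficients vanishing at infinity. -/
def HasHoweMoore (G : Type) [Group G] [TopologicalSpace G] : Prop :=
  ∀ (H : Type) [NormedAddCommGroup H] [InnerProductSpace ℂ H] [CompleteSpace H]
    (π : UnitaryRep G H), NoInvariantVectors π →
      ∀ v w : H, Tendsto (fun g : G => ⟪π.ρ g v, w⟫_ℂ) (cocompact G) (𝓝 0)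

/-! ### Legal colorings and the universal groups of Burger–Mozes -/

/-- A legal coloring of a `d`-regular tree: a coloring of the (unoriented) edges by
`{1, …, d}` whose restriction to the star of each vertex is a bijection onto `{1, …, d}`.
The color of the edge `{x, y}` is recorded as `color x y` with `color x y = color y x`. -/
structure LegalColoring (T : SimpleGraph V) (d : ℕ) where
  color : V → V → Fin d
  symm : ∀ x y : V, T.Adj x y → color x y = color y x
  injOn : ∀ x : V, Set.InjOn (color x) (T.neighborSet x)
  surjOn : ∀ x : V, Set.SurjOn (color x) (T.neighborSet x) Set.univ

/-- Membership in the universal group `U(F)`: at every vertex `x` the local action of `g`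
on colors is given by an element of `F`. -/
def InUF {d : ℕ} (T : SimpleGraph V) (F : Subgroup (Equiv.Perm (Fin d)))
    (ι : LegalColoring T d) (g : T ≃g T) : Prop :=
  ∀ x : V, ∃ σ ∈ F, ∀ y : V, T.Adj x y → σ (ι.color x y) = ι.color (g x) (g y)

/-- The universal group `U(F)⁺`: the subgroup of `Aut(T)` generated by the elements of
`U(F)` fixing (pointwise) an edge of `T`. -/
def UFplus {d : ℕ} (T : SimpleGraph V) (F : Subgroup (Equiv.Perm (Fin d)))
    (ι : LegalColoring T d) : Subgroup (T ≃g T) :=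
  Subgroup.closure
    {g : T ≃g T | InUF T F ι g ∧ ∃ x y : V, T.Adj x y ∧ g x = x ∧ g y = y}

/-! ### Permutation group conditions -/

/-- `F` acts transitively on `{1, …, d}`. -/
def PermTransitive {d : ℕ} (F : Subgroup (Equiv.Perm (Fin d))) : Prop :=
  ∀ i j : Fin d, ∃ σ ∈ F, σ i = j

/-- `F` acts 2-transitively on `{1, …, d}`. -/
def PermTwoTransitive {d : ℕ} (F : Subgroup (Equiv.Perm (Fin d))) : Prop :=
  ∀ a b c e : Fin d, a ≠ b → c ≠ e → ∃ σ ∈ F, σ a = c ∧ σ b = e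

/-- `F` acts primitively on `{1, …, d}`: it is transitive and every block of the action
is trivial (a subsingleton or the whole set). -/
def PermPrimitive {d : ℕ} (F : Subgroup (Equiv.Perm (Fin d))) : Prop :=
  PermTransitive F ∧
    ∀ B : Set (Fin d),
      (∀ σ ∈ F, (σ : Equiv.Perm (Fin d)) '' B = B ∨
        Disjoint ((σ : Equiv.Perm (Fin d)) '' B) B) →
      B.Subsingleton ∨ B = Set.univ

/-- `F` is a cyclic group of prime order. -/
def CyclicOfPrimeOrder {d : ℕ} (F : Subgroup (Equiv.Perm (Fin d))) : Prop :=
  IsCyclic F ∧ (Nat.card F).Prime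

/-- `F` is generated by its point stabilizers `F_i = {σ ∈ F : σ i = i}`. -/
def GenByPointStabilizers {d : ℕ} (F : Subgroup (Equiv.Perm (Fin d))) : Prop :=
  F = Subgroup.closure {σ : Equiv.Perm (Fin d) | σ ∈ F ∧ ∃ i : Fin d, σ i = i}




section geom
variable {V : Type} {T : SimpleGraph V}

theorem t_step (hT : T.IsTree) (w : V) {u v : V} (h : T.Adj u v) :
    T.dist w v = T.dist w u + 1 ∨ T.dist w u = T.dist w v + 1 := by
  rcases hT.dist_eq_dist_add_one_of_adj w h with h | h
  · right; exact h
  · left; exact h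

theorem t_tri (hT : T.IsTree) (u v w : V) : T.dist u w ≤ T.dist u v + T.dist v w :=
  hT.connected.dist_triangle

theorem t_zero (hT : T.IsTree) {u v : V} (h : T.dist u v = 0) : u = v :=
  hT.connected.dist_eq_zero_iff.mp h

theorem t_one {u v : V} (h : T.Adj u v) : T.dist u v = 1 :=
  SimpleGraph.dist_eq_one_iff_adj.mpr h

theorem t_uniq (hT : T.IsTree) {w u u' v : V} (h : T.Adj u v) (h' : T.Adj u' v)
    (hd : T.dist w v = T.dist w u + 1) (hd' : T.dist w v = T.dist w u' + 1) : u = u' := by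
  obtain ⟨p, hp⟩ := hT.connected.exists_walk_length_eq_dist w u
  obtain ⟨p', hp'⟩ := hT.connected.exists_walk_length_eq_dist w u'
  have h1 : (p.concat h).IsPath :=
    SimpleGraph.Walk.isPath_of_length_eq_dist _ (by simp [hp, hd])
  have h2 : (p'.concat h').IsPath :=
    SimpleGraph.Walk.isPath_of_length_eq_dist _ (by simp [hp', hd'])
  have := (hT.existsUnique_path w v).unique h1 h2
  have h3 := congrArg SimpleGraph.Walk.penultimate this
  simpa using h3

theorem t_pred (hT : T.IsTree) {w v : V} (h : w ≠ v) :
    ∃ u, T.Adj u v ∧ T.dist w v = T.dist w u + 1 := by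
  obtain ⟨p, hp⟩ := hT.connected.exists_walk_length_eq_dist v w
  cases p with
  | nil => exact absurd rfl h
  | cons ha q =>
    rename_i u
    refine ⟨u, ha.symm, ?_⟩
    have h1 : T.dist u w ≤ q.length := SimpleGraph.dist_le _
    simp only [SimpleGraph.Walk.length_cons] at hp
    have h2 := t_tri hT v u w
    rw [t_one ha] at h2
    rw [SimpleGraph.dist_comm (u := w), SimpleGraph.dist_comm (u := w)]
    omega

/-- half-space lemma -/
theorem t_half (hT : T.IsTree) {p q w : V} (hpq : T.Adj p q) (hw : T.dist w p = T.dist w q + 1) :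
    ∀ (k : ℕ) (w' : V), T.dist p w' = k → T.dist q w' = k + 1 →
      T.dist w w' = T.dist w p + k := by
  intro k
  induction k using Nat.strong_induction_on with
  | _ k ih =>
  intro w' hp hq
  rcases Nat.eq_zero_or_pos k with rfl | hk
  · rw [← t_zero hT hp]; simp
  have hne : p ≠ w' := by rintro rfl; simp at hp; omega
  obtain ⟨u, hu, hdu⟩ := t_pred hT hne
  have hqu : T.dist q u = k := by
    rcases t_step hT q hu with h | h
    · omega
    · have := t_tri hT p q u
      have h3 := t_tri hT q p u
      rw [t_one hpq] at this
      rw [t_one hpq.symm] at h3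
      omega
  have hwu := ih (k-1) (by omega) u (by omega) (by omega)
  rcases t_step hT w hu with h | h
  · omega
  exfalso
  by_cases hup : p = u
  · subst hup
    have : w' = q := t_uniq hT hu.symm hpq.symm h hw
    subst this
    simp at hq
  · obtain ⟨u2, hu2, hdu2⟩ := t_pred hT hup
    have hqu2 : T.dist q u2 = k - 1 := by
      rcases t_step hT q hu2 with h | h
      · omega
      · have := t_tri hT q p u2
        have h3 := t_tri hT p q u2
        rw [t_one hpq.symm] at this
        rw [t_one hpq] at h3
        omega
    have hwu2 := ih (k-2) (by omega) u2 (by omega) (by omega)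
    have : w' = u2 := t_uniq hT hu.symm hu2 h (by omega)
    subst this
    omega

theorem r_dist (r : GeodRay T) (m k : ℕ) : T.dist (r.seq m) (r.seq (m + k)) = k := by
  rw [r.geodesic, Nat.dist]; omega

theorem r_dist0 (r : GeodRay T) (k : ℕ) : T.dist (r.seq 0) (r.seq k) = k := by
  have := r_dist r 0 k
  simpa using this

theorem r_nb (r : GeodRay T) (n : ℕ) : r.seq n ≠ r.seq (n + 2) := by
  intro h
  have := r_dist r n 2
  rw [← h] at this
  simp at this

theorem r_inj (r : GeodRay T) {m n : ℕ} (h : r.seq m = r.seq n) : m = n := by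
  have := r.geodesic m n
  rw [h, SimpleGraph.dist_self, Nat.dist] at this
  omega

theorem exists_ray (hT : T.IsTree) (s : ℕ → V) (ha : ∀ n, T.Adj (s n) (s (n + 1)))
    (hnb : ∀ n, s n ≠ s (n + 2)) : ∃ r : GeodRay T, r.seq = s := by
  have key : ∀ m k, T.dist (s m) (s (m + k)) = k ∧ T.dist (s m) (s (m + k + 1)) = k + 1 := by
    intro m k
    induction k with
    | zero => simp [t_one (ha m)]
    | succ k ih =>
      refine ⟨ih.2, ?_⟩
      rcases t_step hT (s m) (ha (m + (k + 1))) with h | h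
      · rw [h]; have := ih.2; rw [← add_assoc, this]
      · exfalso
        have e := t_uniq hT (ha (m + (k + 1))).symm (ha (m + k)) (w := s m) h
          (by rw [ih.1]; exact ih.2)
        exact hnb (m + k) e.symm
  refine ⟨⟨s, ha, ?_⟩, rfl⟩
  intro m n
  rcases le_total m n with h | h
  · obtain ⟨k, rfl⟩ := Nat.exists_eq_add_of_le h
    rw [(key m k).1, Nat.dist]; omega
  · obtain ⟨k, rfl⟩ := Nat.exists_eq_add_of_le h
    rw [SimpleGraph.dist_comm, (key n k).1, Nat.dist]; omega

def tail (r : GeodRay T) (k : ℕ) : GeodRay T where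
  seq := fun n => r.seq (k + n)
  adj := fun n => r.adj (k + n)
  geodesic := fun m n => by rw [r.geodesic, Nat.dist, Nat.dist]; omega

theorem re_refl (r : GeodRay T) : RayEquiv T r r := ⟨0, 0, fun _ => rfl⟩

theorem re_symm {r s : GeodRay T} (h : RayEquiv T r s) : RayEquiv T s r := by
  obtain ⟨k, l, h⟩ := h
  exact ⟨l, k, fun n => (h n).symm⟩

theorem re_trans {r s t : GeodRay T} (h : RayEquiv T r s) (h' : RayEquiv T s t) :
    RayEquiv T r t := by
  obtain ⟨k, l, h⟩ := h
  obtain ⟨k', l', h'⟩ := h'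
  refine ⟨k + k', l' + l, fun n => ?_⟩
  have h1 := h (k' + n)
  have h2 := h' (l + n)
  rw [show k + k' + n = k + (k' + n) by ring, h1, show l' + l + n = l' + (l + n) by ring, ← h2]
  congr 1; ring

theorem re_map (g : T ≃g T) {r s : GeodRay T} (h : RayEquiv T r s) :
    RayEquiv T (mapRay T g r) (mapRay T g s) := by
  obtain ⟨k, l, h⟩ := h
  exact ⟨k, l, fun n => congrArg g (h n)⟩

theorem re_of_seq {r s : GeodRay T} (h : ∀ n, r.seq n = s.seq n) : RayEquiv T r s :=
  ⟨0, 0, fun _ => h _⟩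

theorem re_tail (r : GeodRay T) (k : ℕ) : RayEquiv T r (tail r k) :=
  ⟨k, 0, fun n => by simp [tail]⟩

theorem re_map_inv {g : T ≃g T} {r s : GeodRay T} (h : RayEquiv T (mapRay T g r) s) :
    RayEquiv T (mapRay T g⁻¹ s) r := by
  obtain ⟨k, l, h⟩ := h
  refine ⟨l, k, fun n => ?_⟩
  have := h n
  simp only [mapRay] at this ⊢
  rw [← this]
  simp

theorem re_map_mul {g h : T ≃g T} {r s t : GeodRay T} (h1 : RayEquiv T (mapRay T g r) s)
    (h2 : RayEquiv T (mapRay T h s) t) : RayEquiv T (mapRay T (h * g) r) t := by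
  refine re_trans ?_ h2
  exact re_map h h1

theorem prepend (hT : T.IsTree) (x : V) : ∀ (k : ℕ) (s : GeodRay T), T.dist x (s.seq 0) = k →
    T.dist x (s.seq 1) = k + 1 → ∃ r : GeodRay T, r.seq 0 = x ∧ ∀ n, r.seq (k + n) = s.seq n := by
  intro k
  induction k with
  | zero =>
    intro s h0 _
    exact ⟨s, (t_zero hT h0).symm, fun n => by simp⟩
  | succ k ih =>
    intro s h0 h1
    have hne : x ≠ s.seq 0 := by intro h; rw [← h] at h0; simp at h0
    obtain ⟨u, hu, hdu⟩ := t_pred hT hne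
    obtain ⟨s', hs'⟩ := exists_ray hT (fun n => Nat.casesOn n u s.seq) (by
      intro n; cases n with
      | zero => exact hu
      | succ n => exact s.adj n) (by
      intro n; cases n with
      | zero =>
        show u ≠ s.seq 1
        rintro rfl; omega
      | succ n => exact r_nb s n)
    have e0 : s'.seq 0 = u := congrFun hs' 0
    have e1 : ∀ n, s'.seq (n + 1) = s.seq n := by intro n; rw [hs']
    obtain ⟨r, hr0, hr⟩ := ih s' (by rw [e0]; omega) (by rw [e1 0]; omega)
    refine ⟨r, hr0, fun n => ?_⟩
    rw [show k + 1 + n = k + (n + 1) by ring, hr, e1]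

theorem to_base (hT : T.IsTree) (s : GeodRay T) (x : V) :
    ∃ r : GeodRay T, r.seq 0 = x ∧ RayEquiv T s r := by
  have : ∃ n, T.dist x (s.seq (n + 1)) = T.dist x (s.seq n) + 1 := by
    by_contra hcon
    push Not at hcon
    have : ∀ n, T.dist x (s.seq n) + n = T.dist x (s.seq 0) := by
      intro n
      induction n with
      | zero => rfl
      | succ n ih =>
        rcases t_step hT x (s.adj n) with h | h
        · exact absurd h (hcon n)
        · omega
    have := this (T.dist x (s.seq 0) + 1)
    omega
  obtain ⟨n, hn⟩ := this
  obtain ⟨r, h0, hr⟩ := prepend hT x _ (tail s n) rfl hn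
  refine ⟨r, h0, n, T.dist x ((tail s n).seq 0), fun m => ?_⟩
  rw [hr]; rfl

theorem back (hT : T.IsTree) {r s : GeodRay T} (h0 : r.seq 0 = s.seq 0) :
    ∀ {k : ℕ}, r.seq k = s.seq k → ∀ i ≤ k, r.seq i = s.seq i := by
  intro k
  induction k with
  | zero => intro h i hi; obtain rfl : i = 0 := by omega
            exact h
  | succ k ih =>
    intro h i hi
    rcases Nat.lt_or_ge i (k+1) with hi' | hi'
    · refine ih ?_ i (by omega)
      apply t_uniq hT (w := r.seq 0) (r.adj k) (h ▸ s.adj k)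
      · rw [r_dist0, r_dist0]
      · rw [r_dist0, h0, r_dist0]
    · obtain rfl : i = k + 1 := by omega
      exact h

theorem uniq (hT : T.IsTree) {r s : GeodRay T} (h0 : r.seq 0 = s.seq 0) (h : RayEquiv T r s)
    (n : ℕ) : r.seq n = s.seq n := by
  obtain ⟨k, l, h⟩ := h
  have e : k = l := by
    have := h 0
    have h1 := r_dist0 r (k + 0)
    rw [this, h0, r_dist0] at h1
    omega
  subst e
  exact back hT h0 (h n) n (by omega)

/-- if `b` starts at `m` leaving away from `w`, `c` too, then any automorphism fixing `w` and
moving the end of `b` to the end of `c` maps the ray `b` to `c`. -/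
theorem pass (hT : T.IsTree) {b c : GeodRay T} {w : V} (hbc : b.seq 0 = c.seq 0)
    (hb : T.dist w (b.seq 1) = T.dist w (b.seq 0) + 1)
    (hc : T.dist w (c.seq 1) = T.dist w (c.seq 0) + 1) {g : T ≃g T} (hg : g w = w)
    (h : RayEquiv T (mapRay T g b) c) (n : ℕ) : g (b.seq n) = c.seq n := by
  obtain ⟨b', hb0, hb'⟩ := prepend hT w _ b rfl hb
  obtain ⟨c', hc0, hc'⟩ := prepend hT w _ c rfl hc
  have e1 : RayEquiv T b' b := ⟨_, 0, fun n => by rw [hb']; simp⟩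
  have e2 : RayEquiv T c' c := ⟨_, 0, fun n => by rw [hc']; simp⟩
  have e3 : RayEquiv T (mapRay T g b') c' := re_trans (re_map g e1) (re_trans h (re_symm e2))
  have := uniq hT (r := mapRay T g b') (s := c') (by simp [mapRay, hb0, hc0, hg]) e3
    (T.dist w (b.seq 0) + n)
  simp only [mapRay] at this
  rw [hb', hbc, hc'] at this
  exact this

theorem away (hT : T.IsTree) {w m a b : V} (ha : T.Adj m a) (hb : T.Adj m b)
    (hw : T.dist w m = T.dist w a + 1) (hab : b ≠ a) : T.dist w b = T.dist w m + 1 := by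
  rcases t_step hT w hb with h | h
  · exact h
  · exact absurd (t_uniq hT hb.symm ha.symm h hw) hab

end geom

section reg
variable {V : Type} {T : SimpleGraph V} {d : ℕ}

theorem nb_fin (hd : 3 ≤ d) (hreg : Regular T d) (x : V) : (T.neighborSet x).Finite :=
  Set.finite_of_ncard_ne_zero (by rw [hreg x]; omega)

theorem ex_nb (hd : 3 ≤ d) (hreg : Regular T d) (x a b : V) : ∃ y, T.Adj x y ∧ y ≠ a ∧ y ≠ b := by
  by_contra hcon
  push Not at hcon
  have hsub : T.neighborSet x ⊆ {a, b} := by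
    intro y hy
    by_cases h : y = a
    · simp [h]
    · simp [hcon y hy h]
  have := Set.ncard_le_ncard hsub (by simp)
  have h2 : ({a, b} : Set V).ncard ≤ 2 := by
    have := Set.ncard_insert_le a {b}
    simpa using this
  rw [hreg x] at this
  omega

theorem ball_fin (hT : T.IsTree) (hd : 3 ≤ d) (hreg : Regular T d) (x : V) (n : ℕ) :
    {y | T.dist x y ≤ n}.Finite := by
  induction n with
  | zero =>
    apply (Set.finite_singleton x).subset
    intro y hy
    exact (t_zero hT (Nat.le_zero.mp hy)).symm
  | succ n ih =>
    apply (ih.union (ih.biUnion (fun y _ => nb_fin hd hreg y))).subset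
    intro y hy
    by_cases h : x = y
    · left; simp [h]
    · right
      obtain ⟨u, hu, hdu⟩ := t_pred hT h
      simp only [Set.mem_iUnion, Set.mem_ofPred_eq] at hy ⊢
      exact ⟨u, by omega, hu⟩

theorem v_countable (hT : T.IsTree) (hd : 3 ≤ d) (hreg : Regular T d) : Countable V := by
  obtain ⟨x⟩ := hT.connected.nonempty
  rw [← Set.countable_univ_iff]
  apply (Set.countable_iUnion (fun n => (ball_fin hT hd hreg x n).countable)).mono
  intro y _
  simp only [Set.mem_iUnion]
  exact ⟨T.dist x y, by simp⟩

theorem edge_ray (hT : T.IsTree) (hd : 3 ≤ d) (hreg : Regular T d) {u v : V} (h : T.Adj u v) :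
    ∃ r : GeodRay T, r.seq 0 = u ∧ r.seq 1 = v := by
  choose f hf1 hf2 _ using ex_nb hd hreg
  let P : ℕ → V × V := fun n => Nat.rec (u, v) (fun _ p => (p.2, f p.2 p.1 p.1)) n
  have hP : ∀ n, P (n + 1) = ((P n).2, f (P n).2 (P n).1 (P n).1) := fun n => rfl
  have h1 : ∀ n, (P (n + 1)).1 = (P n).2 := fun n => rfl
  have hadj : ∀ n, T.Adj (P n).1 (P n).2 := by
    intro n; cases n with
    | zero => exact h
    | succ n => rw [hP]; exact hf1 _ _ _
  obtain ⟨r, hr⟩ := exists_ray hT (fun n => (P n).1) (fun n => by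
      show T.Adj (P n).1 (P (n + 1)).1
      rw [h1]; exact hadj n) (fun n => by
      show (P n).1 ≠ (P (n + 1 + 1)).1
      rw [h1 (n + 1), hP n]
      exact (hf2 _ _ _).symm)
  exact ⟨r, congrFun hr 0, congrFun hr 1⟩

end reg

section top
variable {V : Type} {T : SimpleGraph V} {d : ℕ}

theorem ult_const {α : Type} {β : Type} (F : Ultrafilter α) (φ : α → β) {S : Set β} (hS : S.Finite)
    (h : ∀ᶠ a in (F : Filter α), φ a ∈ S) : ∃ y, ∀ᶠ a in (F : Filter α), φ a = y := by
  have h' : ∀ᶠ a in (F : Filter α), ∃ y ∈ S, φ a = y := by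
    filter_upwards [h] with a ha
    exact ⟨_, ha, rfl⟩
  rw [Ultrafilter.eventually_exists_mem_iff hS] at h'
  obtain ⟨y, _, hy⟩ := h'
  exact ⟨y, hy⟩

theorem t_le_nhds (F : Filter (T ≃g T)) (g : T ≃g T) (h : ∀ y, ∀ᶠ k in F, k y = g y) :
    F ≤ 𝓝 g := by
  let : TopologicalSpace V := ⊥
  have : DiscreteTopology V := ⟨rfl⟩
  rw [nhds_induced, ← Filter.tendsto_iff_comap, tendsto_pi_nhds]
  intro y
  rw [nhds_discrete, tendsto_pure]
  exact h y

theorem eval_cont (x : V) : 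
    letI : TopologicalSpace V := ⊥
    Continuous (fun g : T ≃g T => g x) := by
  let : TopologicalSpace V := ⊥
  exact (continuous_apply x).comp continuous_induced_dom

theorem ult_lim (hT : T.IsTree) (hd : 3 ≤ d) (hreg : Regular T d) (F : Ultrafilter (T ≃g T))
    (v u : V) (hF : ∀ᶠ h in (F : Filter (T ≃g T)), h v = u) :
    ∃ g : T ≃g T, ∀ y, ∀ᶠ h in (F : Filter (T ≃g T)), h y = g y := by
  have h1 : ∀ y, ∃ z, ∀ᶠ h in (F : Filter (T ≃g T)), h y = z := by
    intro y
    apply ult_const F (fun h => h y) (ball_fin hT hd hreg u (T.dist v y))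
    filter_upwards [hF] with h hh
    show T.dist u (h y) ≤ T.dist v y
    rw [← hh, iso_dist_eq]
  have h2 : ∀ y, ∃ z, ∀ᶠ h in (F : Filter (T ≃g T)), h⁻¹ y = z := by
    intro y
    apply ult_const F (fun h => h⁻¹ y) (ball_fin hT hd hreg v (T.dist u y))
    filter_upwards [hF] with h hh
    show T.dist v (h⁻¹ y) ≤ T.dist u y
    rw [← hh, ← iso_dist_eq T h v]
    simp
  choose φ hφ using h1
  choose ψ hψ using h2
  refine ⟨⟨⟨φ, ψ, ?_, ?_⟩, ?_⟩, fun y => hφ y⟩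
  · intro y
    obtain ⟨h, a, b⟩ := ((hφ y).and (hψ (φ y))).exists
    rw [← b, ← a]; simp
  · intro y
    obtain ⟨h, a, b⟩ := ((hψ y).and (hφ (ψ y))).exists
    rw [← b, ← a]; simp
  · intro y z
    obtain ⟨h, a, b⟩ := ((hφ y).and (hφ z)).exists
    show T.Adj (φ y) (φ z) ↔ _
    rw [← a, ← b]
    exact h.map_adj_iff

theorem ult_limG (hT : T.IsTree) (hd : 3 ≤ d) (hreg : Regular T d) {G : Subgroup (T ≃g T)}
    (hc : IsClosed (G : Set (T ≃g T))) (F : Ultrafilter (T ≃g T))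
    (v u : V) (hF : ∀ᶠ h in (F : Filter (T ≃g T)), h v = u)
    (hG : ∀ᶠ h in (F : Filter (T ≃g T)), h ∈ G) :
    ∃ g ∈ G, ∀ y, ∀ᶠ h in (F : Filter (T ≃g T)), h y = g y := by
  obtain ⟨g, hg⟩ := ult_lim hT hd hreg F v u hF
  refine ⟨g, ?_, hg⟩
  exact hc.mem_of_tendsto (b := (F : Filter (T ≃g T))) (f := id) (t_le_nhds _ g hg) hG

theorem cpt (hT : T.IsTree) (hd : 3 ≤ d) (hreg : Regular T d) {G : Subgroup (T ≃g T)}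
    (hc : IsClosed (G : Set (T ≃g T))) (v u : V) :
    IsCompact {g : T ≃g T | g ∈ G ∧ g v = u} := by
  rw [isCompact_iff_ultrafilter_le_nhds']
  intro F hF
  have hF' : ∀ᶠ h in (F : Filter (T ≃g T)), h ∈ G ∧ h v = u := hF
  obtain ⟨g, hg, h⟩ := ult_limG hT hd hreg hc F v u (hF'.mono fun _ h => h.2)
    (hF'.mono fun _ h => h.1)
  refine ⟨g, ⟨hg, ?_⟩, t_le_nhds _ g h⟩
  obtain ⟨k, a, b⟩ := ((h v).and hF').exists
  rw [← a, b.2]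

theorem cpt_of_fin (hT : T.IsTree) (hd : 3 ≤ d) (hreg : Regular T d) {G : Subgroup (T ≃g T)}
    (hc : IsClosed (G : Set (T ≃g T))) (v : V) (h : {y | ∃ g ∈ G, g v = y}.Finite) :
    IsCompact (G : Set (T ≃g T)) := by
  have : (G : Set (T ≃g T)) = ⋃ u ∈ {y | ∃ g ∈ G, g v = y}, {g : T ≃g T | g ∈ G ∧ g v = u} := by
    ext g
    simp only [SetLike.mem_coe, Set.mem_ofPred_eq, Set.mem_iUnion]
    exact ⟨fun h => ⟨g v, ⟨g, h, rfl⟩, h, rfl⟩, fun ⟨_, _, h, _⟩ => h⟩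
  rw [this]
  exact h.isCompact_biUnion (fun u _ => cpt hT hd hreg hc v u)

theorem fin_of_cpt {G : Subgroup (T ≃g T)}
    (hc : IsCompact (G : Set (T ≃g T))) (v : V) : {y | ∃ g ∈ G, g v = y}.Finite := by
  let : TopologicalSpace V := ⊥
  have : DiscreteTopology V := ⟨rfl⟩
  exact (hc.image (eval_cont (T := T) v)).finite_of_discrete

/-- Baire category step. -/
theorem baire_step (hT : T.IsTree) (hd : 3 ≤ d) (hreg : Regular T d) {G : Subgroup (T ≃g T)}
    (hc : IsClosed (G : Set (T ≃g T))) 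
    (htr : ∀ ξ η : GeodRay T, ∃ g ∈ G, RayEquiv T (mapRay T g ξ) η) (x : V) :
    ∃ p q, T.Adj p q ∧ ∀ r s : GeodRay T, r.seq 0 = p → r.seq 1 = q → s.seq 0 = p → s.seq 1 = q →
      ∃ k ∈ G, k x = x ∧ RayEquiv T (mapRay T k r) s := by
  let : TopologicalSpace V := ⊥
  have : DiscreteTopology V := ⟨rfl⟩
  have := v_countable hT hd hreg
  let R : Set (ℕ → V) := {s | ∃ r : GeodRay T, r.seq 0 = x ∧ r.seq = s}
  have hR : R = {s | s 0 = x} ∩ ⋂ n, ({s | T.Adj (s n) (s (n + 1))} ∩ {s | s n ≠ s (n + 2)}) := by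
    ext s
    simp only [R, Set.mem_ofPred_eq, Set.mem_inter_iff, Set.mem_iInter]
    constructor
    · rintro ⟨r, h0, rfl⟩
      exact ⟨h0, fun n => ⟨r.adj n, r_nb r n⟩⟩
    · rintro ⟨h0, h⟩
      obtain ⟨r, hr⟩ := exists_ray hT s (fun n => (h n).1) (fun n => (h n).2)
      exact ⟨r, by rw [hr, h0], hr⟩
  have hpc : ∀ (P : V → V → Prop) (m n : ℕ), IsClosed {s : ℕ → V | P (s m) (s n)} := by
    intro P m n
    have : Continuous fun s : ℕ → V => (s m, s n) := by fun_prop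
    exact (isClosed_discrete {p : V × V | P p.1 p.2}).preimage this
  have hRc : IsClosed R := by
    rw [hR]
    refine IsClosed.inter (hpc (fun a _ => a = x) 0 0) (isClosed_iInter fun n => ?_)
    exact IsClosed.inter (hpc (fun a b => T.Adj a b) _ _) (hpc (fun a b => a ≠ b) _ _)
  have hRk : IsCompact R := by
    refine IsCompact.of_isClosed_subset 
      (isCompact_univ_pi (fun n => (ball_fin hT hd hreg x n).isCompact)) hRc ?_
    rintro s ⟨r, h0, rfl⟩ n _
    have := r_dist0 r n
    rw [h0] at this
    simp [this]
  have : CompactSpace R := isCompact_iff_compactSpace.mp hRk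
  obtain ⟨y, hxy, _⟩ := ex_nb hd hreg x x x
  obtain ⟨ξ, hξ0, _⟩ := edge_ray hT hd hreg hxy
  choose ζ hζ0 hζ using fun v => to_base hT ξ v
  let C : V → Set R := fun v => {s | ∃ g ∈ G, g v = x ∧ ∀ n, g ((ζ v).seq n) = s.1 n}
  have hCc : ∀ v, IsClosed (C v) := by
    intro v
    have hcont : Continuous (fun (g : T ≃g T) (n : ℕ) => g ((ζ v).seq n)) :=
      continuous_pi fun n => eval_cont (T := T) _
    have := ((cpt hT hd hreg hc v x).image hcont).isClosed.preimage 
      (continuous_subtype_val (p := fun s => s ∈ R))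
    convert this using 1
    ext s
    simp only [C, Set.mem_ofPred_eq, Set.mem_preimage, Set.mem_image, funext_iff, and_assoc]
  have hCu : ⋃ v, C v = Set.univ := by
    rw [Set.eq_univ_iff_forall]
    rintro ⟨_, r, hr0, rfl⟩
    obtain ⟨g, hg, he⟩ := htr ξ r
    rw [Set.mem_iUnion]
    refine ⟨g⁻¹ x, g, hg, by simp, fun n => ?_⟩
    refine uniq hT (r := mapRay T g (ζ (g⁻¹ x))) (s := r) ?_ ?_ n
    · simp [mapRay, hζ0, hr0]
    · exact re_trans (re_map g (re_symm (hζ _))) he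
  have : Nonempty R := ⟨⟨ξ.seq, ξ, hξ0, rfl⟩⟩
  obtain ⟨v, s, hs⟩ := nonempty_interior_of_iUnion_of_closed hCc hCu
  obtain ⟨⟨s, hsR⟩, hs⟩ : Nonempty (interior (C v)) := ⟨⟨s, hs⟩⟩
  rw [mem_interior_iff_mem_nhds, nhds_subtype_eq_comap, Filter.mem_comap] at hs
  obtain ⟨W, hW, hWC⟩ := hs
  obtain ⟨N, hN⟩ : ∃ N : ℕ, ∀ t : ℕ → V, (∀ i ≤ N, t i = s i) → t ∈ W := by
    rw [nhds_pi, Filter.mem_pi] at hW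
    obtain ⟨I, hI, t, ht, hsub⟩ := hW
    obtain ⟨N, hN⟩ := hI.bddAbove
    refine ⟨N, fun t' ht' => hsub ?_⟩
    intro i hi
    rw [ht' i (hN hi)]
    exact mem_of_mem_nhds (ht i)
  obtain ⟨σ, hσ0, hσ⟩ := hsR
  refine ⟨σ.seq N, σ.seq (N + 1), σ.adj N, ?_⟩
  have key : ∀ r : GeodRay T, r.seq 0 = σ.seq N → r.seq 1 = σ.seq (N + 1) →
      ∃ g ∈ G, g v = x ∧ RayEquiv T (mapRay T g ξ) r := by
    intro r h0 h1
    obtain ⟨r', hr0, hr'⟩ := prepend hT x N r (by rw [h0, ← hσ0, r_dist0])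
      (by rw [h1, ← hσ0, r_dist0])
    have hmem : (⟨r'.seq, r', hr0, rfl⟩ : R) ∈ C v := by
      apply hWC
      apply hN
      intro i hi
      have := hr' 0
      rw [h0] at this
      show _ = _
      rw [← hσ]
      exact back hT (by rw [hr0, hσ0]) this i hi
    obtain ⟨g, hg, hgv, h⟩ := hmem
    refine ⟨g, hg, hgv, ?_⟩
    have e1 : RayEquiv T (mapRay T g (ζ v)) r' := re_of_seq h
    have e2 : RayEquiv T r' r := ⟨N, 0, fun n => by rw [hr']; simp⟩
    exact re_trans (re_map g (hζ v)) (re_trans e1 e2)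
  intro r s h1 h2 h3 h4
  obtain ⟨g, hg, hgv, h⟩ := key r h1 h2
  obtain ⟨g', hg', hgv', h'⟩ := key s h3 h4
  refine ⟨g' * g⁻¹, G.mul_mem hg' (G.inv_mem hg), ?_, re_map_mul (re_map_inv h) h'⟩
  have e : g⁻¹ x = v := by rw [← hgv]; simp
  show g' (g⁻¹ x) = x
  rw [e, hgv']

end top

section main
variable {V : Type} {T : SimpleGraph V} {d : ℕ}

theorem near (hT : T.IsTree) {e s : GeodRay T} (he : RayEquiv T e s) :
    ∃ K, ∀ r : GeodRay T, r.seq K = e.seq K → r.seq (K + 1) = e.seq (K + 1) →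
      ∃ t : GeodRay T, t.seq 0 = s.seq 0 ∧ t.seq 1 = s.seq 1 ∧ RayEquiv T r t := by
  obtain ⟨k, l, h⟩ := he
  refine ⟨k + 1, fun r h0 h1 => ?_⟩
  have e0 : (tail r (k + 1)).seq 0 = s.seq (l + 1) := by
    show r.seq (k + 1) = _
    rw [h0, h 1]
  have e1 : (tail r (k + 1)).seq 1 = s.seq (l + 1 + 1) := by
    show r.seq (k + 1 + 1) = _
    rw [h1]; exact h 2
  obtain ⟨t, ht0, ht⟩ := prepend hT (s.seq 0) (l + 1) (tail r (k + 1)) (by rw [e0, r_dist0])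
    (by rw [e1, r_dist0])
  refine ⟨t, ht0, ?_, k + 1, l + 1, fun n => ?_⟩
  · have := ht 0
    rw [e0] at this
    exact back hT ht0 this 1 (by omega)
  · rw [ht]; rfl

theorem unif (hT : T.IsTree) (hd : 3 ≤ d) (hreg : Regular T d) {G : Subgroup (T ≃g T)}
    (htr : ∀ ξ η : GeodRay T, ∃ g ∈ G, RayEquiv T (mapRay T g ξ) η) (x p q : V)
    (hpq : T.Adj p q) :
    ∃ n, ∀ r s : GeodRay T, r.seq 0 = x → s.seq 0 = x → (∀ i ≤ n, r.seq i = s.seq i) →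
      ∃ h ∈ G, T.dist x (h⁻¹ x) ≤ n ∧
        (∃ t : GeodRay T, t.seq 0 = p ∧ t.seq 1 = q ∧ RayEquiv T (mapRay T h r) t) ∧
        (∃ t : GeodRay T, t.seq 0 = p ∧ t.seq 1 = q ∧ RayEquiv T (mapRay T h s) t) := by
  by_contra hcon
  push Not at hcon
  choose r s hr0 hs0 hrs hno using hcon
  let F : Ultrafilter ℕ := Filter.hyperfilter ℕ
  have hF : (F : Filter ℕ) ≤ atTop := Nat.hyperfilter_le_atTop
  have h1 : ∀ n, ∃ y, ∀ᶠ m in (F : Filter ℕ), (r m).seq n = y := by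
    intro n
    apply ult_const F _ (ball_fin hT hd hreg x n)
    refine Filter.Eventually.of_forall fun m => ?_
    show T.dist x ((r m).seq n) ≤ n
    rw [← hr0 m, r_dist0]
  choose ε hε using h1
  obtain ⟨e, he⟩ := exists_ray hT ε (fun n => by
    obtain ⟨m, a, b⟩ := ((hε n).and (hε (n + 1))).exists
    rw [← a, ← b]; exact (r m).adj n) (fun n => by
    obtain ⟨m, a, b⟩ := ((hε n).and (hε (n + 2))).exists
    rw [← a, ← b]; exact r_nb (r m) n)
  obtain ⟨t, ht0, ht1⟩ := edge_ray hT hd hreg hpq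
  obtain ⟨h, hh, hht⟩ := htr e t
  obtain ⟨K, hK⟩ := near hT hht
  rw [ht0, ht1] at hK
  obtain ⟨m, ⟨a, b⟩, c⟩ := (((hε K).and (hε (K + 1))).and
    (hF (eventually_ge_atTop (K + 1 + T.dist x (h⁻¹ x))))).exists
  obtain ⟨t1, u1, u2, u3⟩ := hK (mapRay T h (r m)) (by simp [mapRay, he, a])
    (by simp [mapRay, he, b])
  obtain ⟨t2, w1, w2, w3⟩ := hK (mapRay T h (s m))
    (by simp [mapRay, he, ← hrs m K (by omega), a])
    (by simp [mapRay, he, ← hrs m (K + 1) (by omega), b])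
  exact hno m h hh (by omega) ⟨t1, u1, u2, u3⟩ t2 w1 w2 w3

theorem ex_alpha (hT : T.IsTree) (hd : 3 ≤ d) (hreg : Regular T d) {G : Subgroup (T ≃g T)}
    (x : V) (hinf : ¬ {y | ∃ g ∈ G, g x = y}.Finite) :
    ∃ (F : Ultrafilter G) (α : GeodRay T),
      (∀ n, ∀ᶠ g : G in (F : Filter G), T.dist ((g : T ≃g T)⁻¹ x) (α.seq n) =
        T.dist ((g : T ≃g T)⁻¹ x) (α.seq (n + 1)) + 1) ∧
      (∀ (y : V) (R : ℕ), ∀ᶠ g : G in (F : Filter G), R < T.dist ((g : T ≃g T)⁻¹ x) y) := by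
  let f : G → V := fun g => (g : T ≃g T)⁻¹ x
  have hrange : Set.range f = {y | ∃ g ∈ G, g x = y} := by
    ext y
    constructor
    · rintro ⟨g, rfl⟩
      exact ⟨_, G.inv_mem g.2, rfl⟩
    · rintro ⟨g, hg, rfl⟩
      exact ⟨⟨g⁻¹, G.inv_mem hg⟩, by simp [f]⟩
  have hne : (Filter.comap f Filter.cofinite).NeBot := by
    rw [Filter.comap_neBot_iff]
    intro t ht
    rw [Filter.mem_cofinite] at ht
    by_contra hcon
    push Not at hcon
    apply hinf
    rw [← hrange]
    apply ht.subset
    rintro _ ⟨g, rfl⟩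
    exact hcon g
  let F : Ultrafilter G := Ultrafilter.of (Filter.comap f Filter.cofinite)
  have hF : (F : Filter G) ≤ Filter.comap f Filter.cofinite := Ultrafilter.of_le _
  have hfar : ∀ (y : V) (R : ℕ), ∀ᶠ g : G in (F : Filter G), R < T.dist (f g) y := by
    intro y R
    have h1 : ∀ᶠ v in Filter.cofinite, R < T.dist v y := by
      rw [Filter.eventually_cofinite]
      apply (ball_fin hT hd hreg y R).subset
      intro v hv
      show T.dist y v ≤ R
      rw [SimpleGraph.dist_comm]
      exact Nat.le_of_not_lt hv
    exact hF (h1.comap f)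
  have hstep : ∀ y, ∃ y', T.Adj y y' ∧
      ∀ᶠ g : G in (F : Filter G), T.dist (f g) y = T.dist (f g) y' + 1 := by
    intro y
    have h1 : ∀ᶠ g : G in (F : Filter G), ∃ y' ∈ T.neighborSet y,
        T.dist (f g) y = T.dist (f g) y' + 1 := by
      filter_upwards [hfar y 0] with g hg
      obtain ⟨u, hu, hd⟩ := t_pred hT (w := f g) (v := y) (by
        intro h; rw [h] at hg; simp at hg)
      exact ⟨u, hu.symm, hd⟩
    rw [Ultrafilter.eventually_exists_mem_iff (nb_fin hd hreg y)] at h1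
    exact h1
  choose N hN1 hN2 using hstep
  have hit : ∀ n, N^[n + 1] x = N (N^[n] x) := fun n => Function.iterate_succ_apply' N n x
  obtain ⟨α, hα⟩ := exists_ray hT (fun n => N^[n] x)
    (fun n => by show T.Adj (N^[n] x) (N^[n + 1] x); rw [hit]; exact hN1 _) (fun n => by
      show N^[n] x ≠ N^[n + 1 + 1] x
      intro h
      obtain ⟨g, a, b⟩ := ((hN2 (N^[n] x)).and (hN2 (N^[n+1] x))).exists
      rw [← hit] at a b
      rw [← h] at b
      omega)
  refine ⟨F, α, fun n => ?_, hfar⟩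
  have := hN2 (N^[n] x)
  rw [← hit] at this
  rw [hα]
  exact this

theorem toward (hT : T.IsTree) (a : GeodRay T) (w : V) : ∀ k : ℕ,
    T.dist w (a.seq k) = T.dist w (a.seq (k + 1)) + 1 →
    T.dist w (a.seq 0) = T.dist w (a.seq 1) + 1 := by
  intro k
  induction k with
  | zero => exact id
  | succ k ih =>
    intro h
    exact ih (away hT (a.adj (k + 1)) (a.adj k).symm h (r_nb a k))

theorem claim1 (hT : T.IsTree) {G : Subgroup (T ≃g T)} (x p q : V)
    (hpq : ∀ r s : GeodRay T, r.seq 0 = p → r.seq 1 = q → s.seq 0 = p → s.seq 1 = q →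
      ∃ k ∈ G, k x = x ∧ RayEquiv T (mapRay T k r) s)
    (n : ℕ) (hn : ∀ r s : GeodRay T, r.seq 0 = x → s.seq 0 = x → (∀ i ≤ n, r.seq i = s.seq i) →
      ∃ h ∈ G, T.dist x (h⁻¹ x) ≤ n ∧
        (∃ t : GeodRay T, t.seq 0 = p ∧ t.seq 1 = q ∧ RayEquiv T (mapRay T h r) t) ∧
        (∃ t : GeodRay T, t.seq 0 = p ∧ t.seq 1 = q ∧ RayEquiv T (mapRay T h s) t))
    (F : Ultrafilter G) (α : GeodRay T)
    (hα : ∀ n, ∀ᶠ g : G in (F : Filter G), T.dist ((g : T ≃g T)⁻¹ x) (α.seq n) =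
        T.dist ((g : T ≃g T)⁻¹ x) (α.seq (n + 1)) + 1)
    (hfar : ∀ (y : V) (R : ℕ), ∀ᶠ g : G in (F : Filter G), R < T.dist ((g : T ≃g T)⁻¹ x) y)
    (a b c : GeodRay T) (ha : RayEquiv T a α) (hb0 : b.seq 0 = a.seq 0) (hc0 : c.seq 0 = a.seq 0)
    (hb1 : b.seq 1 ≠ a.seq 1) (hc1 : c.seq 1 ≠ a.seq 1) :
    ∃ g ∈ G, g (a.seq 0) = a.seq 0 ∧ RayEquiv T (mapRay T g b) c := by
  obtain ⟨k, l, hkl⟩ := ha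
  obtain ⟨⟨g, hg⟩, hg1, hg2⟩ := ((hα l).and (hfar (a.seq 0) n)).exists
  simp only at hg1 hg2
  have hbadj : T.Adj (a.seq 0) (b.seq 1) := hb0 ▸ b.adj 0
  have hcadj : T.Adj (a.seq 0) (c.seq 1) := hc0 ▸ c.adj 0
  have hwa : T.dist (g⁻¹ x) (a.seq 0) = T.dist (g⁻¹ x) (a.seq 1) + 1 := by
    apply toward hT a _ k
    have e0 := hkl 0
    have e1 := hkl 1
    simp only [add_zero] at e0
    rw [e0, e1]; exact hg1
  obtain ⟨β, hβ0, hβ⟩ := prepend hT (g⁻¹ x) _ b (congrArg _ hb0) 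
    (away hT (a.adj 0) hbadj hwa hb1)
  obtain ⟨γ, hγ0, hγ⟩ := prepend hT (g⁻¹ x) _ c (congrArg _ hc0) 
    (away hT (a.adj 0) hcadj hwa hc1)
  have hβγ : ∀ i ≤ T.dist (g⁻¹ x) (a.seq 0), β.seq i = γ.seq i :=
    back hT (by rw [hβ0, hγ0]) (by
      have h1 := hβ 0
      have h2 := hγ 0
      simp only [add_zero] at h1 h2
      rw [h1, h2, hb0, hc0])
  obtain ⟨h, hh, hdist, ⟨t1, u1, u2, u3⟩, ⟨t2, v1, v2, v3⟩⟩ := hn (mapRay T g β) (mapRay T g γ)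
    (by simp [mapRay, hβ0]) (by simp [mapRay, hγ0]) (fun i hi => by
      simp only [mapRay]; rw [hβγ i (by omega)])
  obtain ⟨κ, hκ, hκx, hκt⟩ := hpq t1 t2 u1 u2 v1 v2
  have eb : RayEquiv T (mapRay T (h * g) b) t1 := by
    have : RayEquiv T b β := ⟨0, _, fun n => by rw [hβ]; simp⟩
    exact re_trans (re_map (h * g) this) u3
  have ec : RayEquiv T (mapRay T (h * g) c) t2 := by
    have : RayEquiv T c γ := ⟨0, _, fun n => by rw [hγ]; simp⟩
    exact re_trans (re_map (h * g) this) v3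
  have hmem : h * g ∈ G := G.mul_mem hh hg
  have hfix : ((h * g)⁻¹ * (κ * (h * g))) (g⁻¹ (h⁻¹ x)) = g⁻¹ (h⁻¹ x) := by
    have e1 : (h * g) (g⁻¹ (h⁻¹ x)) = x := by
      show h (g (g⁻¹ (h⁻¹ x))) = x
      simp
    show (h * g)⁻¹ (κ ((h * g) (g⁻¹ (h⁻¹ x)))) = _
    rw [e1, hκx, mul_inv_rev]
    rfl
  have hbc : RayEquiv T (mapRay T ((h * g)⁻¹ * (κ * (h * g))) b) c :=
    re_map_mul (re_map_mul eb hκt) (re_map_inv ec)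
  have hw' : T.dist (g⁻¹ (h⁻¹ x)) (a.seq 0) = T.dist (g⁻¹ (h⁻¹ x)) (a.seq 1) + 1 := by
    rcases t_step hT (g⁻¹ (h⁻¹ x)) (a.adj 0) with h1 | h1
    · exfalso
      have h2 := t_half hT (a.adj 0) hwa _ (g⁻¹ (h⁻¹ x)) rfl (by
        rw [SimpleGraph.dist_comm, h1, SimpleGraph.dist_comm])
      rw [iso_dist_eq] at h2
      omega
    · exact h1
  refine ⟨_, G.mul_mem (G.inv_mem hmem) (G.mul_mem hκ hmem), ?_, hbc⟩
  have := pass hT (b := b) (c := c) (w := g⁻¹ (h⁻¹ x)) (by rw [hb0, hc0])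
    (by rw [hb0]; exact away hT (a.adj 0) hbadj hw' hb1) 
    (by rw [hc0]; exact away hT (a.adj 0) hcadj hw' hc1) hfix hbc 0
  rw [hb0, hc0] at this
  exact this

theorem iii_i (hT : T.IsTree) (hd : 3 ≤ d) (hreg : Regular T d) {G : Subgroup (T ≃g T)}
    (hc : IsClosed (G : Set (T ≃g T))) (hnc : ¬ IsCompact (G : Set (T ≃g T)))
    (htr : ∀ ξ η : GeodRay T, ∃ g ∈ G, RayEquiv T (mapRay T g ξ) η) :
    ∀ x : V, ∀ ξ η : GeodRay T, ∃ g ∈ G, g x = x ∧ RayEquiv T (mapRay T g ξ) η := by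
  intro x ξ η
  obtain ⟨p, q, hadj, hpq⟩ := baire_step hT hd hreg hc htr x
  obtain ⟨n, hn⟩ := unif hT hd hreg htr x p q hadj
  obtain ⟨F, α, hα, hfar⟩ := ex_alpha hT hd hreg (G := G) x
    (fun h => hnc (cpt_of_fin hT hd hreg hc x h))
  obtain ⟨b, hb0, hb⟩ := to_base hT ξ x
  obtain ⟨c, hc0, hc'⟩ := to_base hT η x
  obtain ⟨y, hxy, hyb, hyc⟩ := ex_nb hd hreg x (b.seq 1) (c.seq 1)
  obtain ⟨a, ha0, ha1⟩ := edge_ray hT hd hreg hxy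
  obtain ⟨h, hh, hha⟩ := htr α a
  obtain ⟨g, hg, hgx, hgbc⟩ := claim1 hT x p q hpq n hn F α hα hfar (mapRay T h⁻¹ a)
    (mapRay T h⁻¹ b) (mapRay T h⁻¹ c) (re_map_inv hha) (by simp [mapRay, ha0, hb0])
    (by simp [mapRay, ha0, hc0])
    (by simp only [mapRay, ha1]; exact fun e => hyb (h⁻¹.injective e).symm)
    (by simp only [mapRay, ha1]; exact fun e => hyc (h⁻¹.injective e).symm)
  refine ⟨h * (g * h⁻¹), G.mul_mem hh (G.mul_mem hg (G.inv_mem hh)), ?_, ?_⟩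
  · simp only [mapRay, ha0] at hgx
    show h (g (h⁻¹ x)) = x
    rw [hgx]; simp
  · have e1 : RayEquiv T (mapRay T (g * h⁻¹) b) (mapRay T h⁻¹ c) := hgbc
    have e2 : RayEquiv T (mapRay T h (mapRay T h⁻¹ c)) c :=
      re_of_seq (fun n => by simp [mapRay])
    exact re_trans (re_map _ hb) (re_trans (re_map_mul e1 e2) (re_symm hc'))

theorem i_nc (hT : T.IsTree) (hd : 3 ≤ d) (hreg : Regular T d) {G : Subgroup (T ≃g T)}
    (h : ∀ x : V, ∀ ξ η : GeodRay T, ∃ g ∈ G, g x = x ∧ RayEquiv T (mapRay T g ξ) η) :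
    ¬ IsCompact (G : Set (T ≃g T)) := by
  intro hcpt
  obtain ⟨x⟩ := hT.connected.nonempty
  have hfin := fin_of_cpt hcpt x
  obtain ⟨y, hxy, _⟩ := ex_nb hd hreg x x x
  obtain ⟨r, hr0, _⟩ := edge_ray hT hd hreg hxy
  have key : ∀ n, ∃ g ∈ G, g x = r.seq (2 * n) := by
    intro n
    induction n with
    | zero => exact ⟨1, G.one_mem, hr0.symm⟩
    | succ n ih =>
      obtain ⟨g, hg, hgx⟩ := ih
      obtain ⟨b, hb0, hb1⟩ := edge_ray hT hd hreg (r.adj (2 * n)).symm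
      obtain ⟨k, hk, hkx, hkb⟩ := h (r.seq (2 * n + 1)) b (tail r (2 * n + 1))
      refine ⟨k * g, G.mul_mem hk hg, ?_⟩
      have := uniq hT (r := mapRay T k b) (s := tail r (2 * n + 1)) 
        (by simp [mapRay, hb0, hkx, tail]) hkb 1
      simp only [mapRay, hb1, tail] at this
      show k (g x) = _
      rw [hgx, this]
      rfl
  have hinj : Function.Injective (fun n => r.seq (2 * n)) := fun m n e => by
    have := r_inj r e
    omega
  exact Set.infinite_range_of_injective hinj (hfin.subset (by rintro _ ⟨n, rfl⟩; exact key n))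

theorem iv_tr (hT : T.IsTree) (hd : 3 ≤ d) (hreg : Regular T d) {G : Subgroup (T ≃g T)}
    (h : ∀ ξ₁ ξ₂ η₁ η₂ : GeodRay T, ¬ RayEquiv T ξ₁ ξ₂ → ¬ RayEquiv T η₁ η₂ →
        ∃ g ∈ G, RayEquiv T (mapRay T g ξ₁) η₁ ∧ RayEquiv T (mapRay T g ξ₂) η₂)
    (ξ η : GeodRay T) : ∃ g ∈ G, RayEquiv T (mapRay T g ξ) η := by
  have ex : ∀ ξ : GeodRay T, ∃ ξ' : GeodRay T, ¬ RayEquiv T ξ ξ' := by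
    intro ξ
    obtain ⟨y, hy, hne, _⟩ := ex_nb hd hreg (ξ.seq 0) (ξ.seq 1) (ξ.seq 1)
    obtain ⟨r, h0, h1⟩ := edge_ray hT hd hreg hy
    refine ⟨r, fun hr => hne ?_⟩
    rw [← h1, uniq hT h0.symm hr 1]
  obtain ⟨ξ', hξ⟩ := ex ξ
  obtain ⟨η', hη⟩ := ex η
  obtain ⟨g, hg, h1, _⟩ := h ξ ξ' η η' hξ hη
  exact ⟨g, hg, h1⟩

theorem iv_nc (hT : T.IsTree) (hd : 3 ≤ d) (hreg : Regular T d) {G : Subgroup (T ≃g T)}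
    (h : ∀ ξ₁ ξ₂ η₁ η₂ : GeodRay T, ¬ RayEquiv T ξ₁ ξ₂ → ¬ RayEquiv T η₁ η₂ →
        ∃ g ∈ G, RayEquiv T (mapRay T g ξ₁) η₁ ∧ RayEquiv T (mapRay T g ξ₂) η₂) :
    ¬ IsCompact (G : Set (T ≃g T)) := by
  intro hcpt
  obtain ⟨x⟩ := hT.connected.nonempty
  have hfin := fin_of_cpt hcpt x
  obtain ⟨M, hM⟩ := (hfin.image (fun y => T.dist x y)).bddAbove
  have hM' : ∀ g ∈ G, T.dist x (g x) ≤ M := fun g hg => 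
    hM ⟨g x, ⟨g, hg, rfl⟩, rfl⟩
  obtain ⟨y1, hy1, _⟩ := ex_nb hd hreg x x x
  obtain ⟨y2, hy2, hy21, _⟩ := ex_nb hd hreg x y1 y1
  obtain ⟨ξ₁, hξ10, hξ11⟩ := edge_ray hT hd hreg hy1
  obtain ⟨ξ₂, hξ20, hξ21⟩ := edge_ray hT hd hreg hy2
  have hξ : ¬ RayEquiv T ξ₁ ξ₂ := fun e => hy21 (by
    rw [← hξ11, ← hξ21, uniq hT (by rw [hξ10, hξ20]) e 1])
  have hy : x ≠ ξ₁.seq (M + 1) := by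
    intro e
    rw [← hξ10] at e
    have := r_inj ξ₁ e
    omega
  let y := ξ₁.seq (M + 1)
  have hxy : T.dist x y = M + 1 := by rw [← hξ10, r_dist0]
  have hyM : T.Adj y (ξ₁.seq M) := (ξ₁.adj M).symm
  have hxm : T.dist x y = T.dist x (ξ₁.seq M) + 1 := by
    rw [hxy, ← hξ10, r_dist0]
  obtain ⟨z1, hz1, hz1m, _⟩ := ex_nb hd hreg y (ξ₁.seq M) (ξ₁.seq M)
  obtain ⟨z2, hz2, hz2m, hz21⟩ := ex_nb hd hreg y (ξ₁.seq M) z1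
  obtain ⟨η₁, hη10, hη11⟩ := edge_ray hT hd hreg hz1
  obtain ⟨η₂, hη20, hη21⟩ := edge_ray hT hd hreg hz2
  have hη : ¬ RayEquiv T η₁ η₂ := fun e => hz21 (by
    rw [← hη11, ← hη21, uniq hT (by rw [hη10, hη20]) e 1])
  obtain ⟨g, hg, e1, e2⟩ := h ξ₁ ξ₂ η₁ η₂ hξ hη
  have hgM := hM' g hg
  have hz : ∀ z, T.Adj y z → z ≠ ξ₁.seq M → T.dist (g x) z = T.dist (g x) y + 1 := by
    intro z hyz hzm
    rcases t_step hT (g x) hyz with h1 | h1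
    · exact h1
    · exfalso
      have h2 := away hT hyM hyz hxm hzm
      have h3 := t_half hT hyz h1 _ x rfl (by
        rw [SimpleGraph.dist_comm, h2, SimpleGraph.dist_comm])
      have h4 := SimpleGraph.dist_comm (G := T) (u := x) (v := y)
      have h5 := SimpleGraph.dist_comm (G := T) (u := x) (v := g x)
      omega
  obtain ⟨β, hβ0, hβ⟩ := prepend hT (g x) _ η₁ (congrArg _ hη10) 
    (by rw [hη11]; exact hz z1 hz1 hz1m)
  obtain ⟨γ, hγ0, hγ⟩ := prepend hT (g x) _ η₂ (congrArg _ hη20) 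
    (by rw [hη21]; exact hz z2 hz2 hz2m)
  have hpos : 1 ≤ T.dist (g x) y := by
    have := t_tri hT x (g x) y
    omega
  have h1 : β.seq 1 = γ.seq 1 := back hT (by rw [hβ0, hγ0]) (by
      have h1 := hβ 0
      have h2 := hγ 0
      simp only [add_zero] at h1 h2
      rw [h1, h2, hη10, hη20]) 1 hpos
  have eb : RayEquiv T (mapRay T g ξ₁) β := re_trans e1 ⟨0, _, fun n => by rw [hβ]; simp⟩
  have ec : RayEquiv T (mapRay T g ξ₂) γ := re_trans e2 ⟨0, _, fun n => by rw [hγ]; simp⟩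
  have h2 := uniq hT (by simp [mapRay, hξ10, hβ0]) eb 1
  have h3 := uniq hT (by simp [mapRay, hξ20, hγ0]) ec 1
  rw [h1, ← h3] at h2
  simp only [mapRay, hξ11, hξ21] at h2
  exact hy21 (g.injective h2).symm

theorem sep (hT : T.IsTree) {a b : GeodRay T} (h : ¬ RayEquiv T a b) :
    ∃ j, ∀ i ≥ j, ∀ b' : GeodRay T, b'.seq 0 = a.seq i → RayEquiv T b b' →
      b'.seq 1 ≠ a.seq (i + 1) := by
  obtain ⟨b₀, h0, hb⟩ := to_base hT b (a.seq 0)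
  have : ∃ j, b₀.seq j ≠ a.seq j := by
    by_contra hcon
    push Not at hcon
    exact h (re_symm (re_trans hb (re_of_seq hcon)))
  obtain ⟨j, hj⟩ := this
  refine ⟨j, fun i hi b' hb0 hbb h1 => hj ?_⟩
  obtain ⟨r, hr0, hr⟩ := prepend hT (a.seq 0) i b' (by rw [hb0, r_dist0]) (by rw [h1, r_dist0])
  have e : RayEquiv T b₀ r := 
    re_trans (re_symm hb) (re_trans hbb ⟨0, i, fun n => by rw [hr]; simp⟩)
  have e2 := hr 0
  rw [hb0] at e2
  rw [uniq hT (by rw [h0, hr0]) e j]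
  exact back hT hr0 e2 j hi

theorem i_iv (hT : T.IsTree) (hd : 3 ≤ d) (hreg : Regular T d) {G : Subgroup (T ≃g T)}
    (hc : IsClosed (G : Set (T ≃g T)))
    (h : ∀ x : V, ∀ ξ η : GeodRay T, ∃ g ∈ G, g x = x ∧ RayEquiv T (mapRay T g ξ) η)
    (ξ₁ ξ₂ η₁ η₂ : GeodRay T) (hξ : ¬ RayEquiv T ξ₁ ξ₂) (hη : ¬ RayEquiv T η₁ η₂) :
    ∃ g ∈ G, RayEquiv T (mapRay T g ξ₁) η₁ ∧ RayEquiv T (mapRay T g ξ₂) η₂ := by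
  obtain ⟨f, hf, _, hfξ⟩ := h (ξ₁.seq 0) ξ₁ η₁
  have hne : ¬ RayEquiv T η₁ (mapRay T f ξ₂) := by
    intro e
    apply hξ
    have e1 := re_map_inv hfξ
    have e2 := re_map_inv (re_symm e)
    exact re_trans (re_symm e1) e2
  obtain ⟨j1, hj1⟩ := sep hT hne
  obtain ⟨j2, hj2⟩ := sep hT hη
  let j := max j1 j2
  let a := tail η₁ j
  obtain ⟨b, hb0, hb⟩ := to_base hT (mapRay T f ξ₂) (a.seq 0)
  obtain ⟨c, hc0, hcc⟩ := to_base hT η₂ (a.seq 0)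
  have hb1 : b.seq 1 ≠ a.seq 1 := hj1 j (le_max_left _ _) b hb0 hb
  have hc1 : c.seq 1 ≠ a.seq 1 := hj2 j (le_max_right _ _) c hc0 hcc
  have hbadj : T.Adj (a.seq 0) (b.seq 1) := hb0 ▸ b.adj 0
  have hcadj : T.Adj (a.seq 0) (c.seq 1) := hc0 ▸ c.adj 0
  choose g hg hgf hgbc using fun i : ℕ => h (a.seq i) b c
  have hd0 : ∀ i, T.dist (a.seq i) (a.seq 0) = i := fun i => by
    rw [SimpleGraph.dist_comm, r_dist0]
  -- rays issued from a point of a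
  have hfar : ∀ b : GeodRay T, b.seq 0 = a.seq 0 → b.seq 1 ≠ a.seq 1 → ∀ i,
      T.dist (a.seq i) (b.seq 1) = i + 1 := by
    intro b hb0 hb1 i
    have hbadj : T.Adj (a.seq 0) (b.seq 1) := hb0 ▸ b.adj 0
    cases i with
    | zero => rw [t_one hbadj]
    | succ i =>
      have := away hT (w := a.seq (i + 1)) (a.adj 0) hbadj (by
        rw [hd0, SimpleGraph.dist_comm, show i + 1 = 1 + i by ring, r_dist]; ring) hb1
      rw [this, hd0]
  have hpass : ∀ i l, l ≤ i → g i (a.seq l) = a.seq l ∧ ∀ n, g i (b.seq n) = c.seq n := by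
    intro i l hl
    obtain ⟨k, rfl⟩ := Nat.exists_eq_add_of_le hl
    have hdk : T.dist (a.seq (l + k)) (a.seq l) = k := by
      rw [SimpleGraph.dist_comm, r_dist]
    obtain ⟨β, hβ0, hβ⟩ := prepend hT (a.seq l) l b (by rw [hb0, hd0]) (hfar b hb0 hb1 l)
    obtain ⟨γ, hγ0, hγ⟩ := prepend hT (a.seq l) l c (by rw [hc0, hd0]) (hfar c hc0 hc1 l)
    have hout : ∀ b β : GeodRay T, b.seq 0 = a.seq 0 → b.seq 1 ≠ a.seq 1 →
        β.seq 0 = a.seq l → (∀ n, β.seq (l + n) = b.seq n) →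
        T.dist (a.seq (l + k)) (β.seq 1) = T.dist (a.seq (l + k)) (β.seq 0) + 1 := by
      intro b β hb0 hb1 hβ0 hβ
      have e1 := hfar b hb0 hb1 (l + k)
      have e2 : T.dist (β.seq 1) (β.seq (1 + l)) = l := r_dist β 1 l
      rw [add_comm, hβ] at e2
      have e3 := t_tri hT (a.seq (l + k)) (β.seq 1) (b.seq 1)
      rcases t_step hT (a.seq (l + k)) (β.adj 0) with e | e
      · exact e
      · rw [hβ0, hdk] at e
        simp only [zero_add] at e
        omega
    have e1 : RayEquiv T β b := ⟨l, 0, fun n => by rw [hβ]; simp⟩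
    have e2 : RayEquiv T γ c := ⟨l, 0, fun n => by rw [hγ]; simp⟩
    have hp := pass hT (b := β) (c := γ) (w := a.seq (l + k)) (by rw [hβ0, hγ0])
      (hout b β hb0 hb1 hβ0 hβ) (hout c γ hc0 hc1 hγ0 hγ) (hgf (l + k))
      (re_trans (re_map _ e1) (re_trans (hgbc (l + k)) (re_symm e2)))
    refine ⟨?_, fun n => ?_⟩
    · have := hp 0
      rwa [hβ0, hγ0] at this
    · have := hp (l + n)
      rwa [hβ, hγ] at this
  let F : Ultrafilter ℕ := Filter.hyperfilter ℕ
  have hF : (F : Filter ℕ) ≤ atTop := Nat.hyperfilter_le_atTop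
  obtain ⟨k, hk, hlim⟩ := ult_limG hT hd hreg hc (F.map g) (a.seq 0) (a.seq 0)
    (by
      rw [Ultrafilter.coe_map, Filter.eventually_map]
      exact Filter.Eventually.of_forall fun i => (hpass i 0 (by omega)).1)
    (by
      rw [Ultrafilter.coe_map, Filter.eventually_map]
      exact Filter.Eventually.of_forall hg)
  have hlim' : ∀ y, ∀ᶠ i in (F : Filter ℕ), g i y = k y := by
    intro y
    have := hlim y
    rwa [Ultrafilter.coe_map, Filter.eventually_map] at this
  have hka : ∀ l, k (a.seq l) = a.seq l := by
    intro l
    obtain ⟨i, e1, e2⟩ := ((hlim' (a.seq l)).and (hF (eventually_ge_atTop l))).exists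
    rw [← e1, (hpass i l e2).1]
  have hkb : ∀ n, k (b.seq n) = c.seq n := by
    intro n
    obtain ⟨i, e1⟩ := (hlim' (b.seq n)).exists
    rw [← e1, (hpass i 0 (by omega)).2]
  refine ⟨k * f, G.mul_mem hk hf, ?_, ?_⟩
  · refine re_map_mul (re_trans hfξ (re_tail η₁ j)) ?_
    exact re_trans (re_of_seq (s := a) hka) (re_symm (re_tail η₁ j))
  · have e1 : RayEquiv T (mapRay T f ξ₂) b := hb
    refine re_map_mul e1 ?_
    exact re_trans (re_of_seq (s := c) hkb) (re_symm hcc)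

end main

/-- For a closed subgroup `G ≤ Aut(𝒯)` of the `d`-regular tree, the
following are equivalent: (i) every vertex stabilizer `G_x` is transitive on `∂𝒯`;
(ii) `G` is non-compact and some vertex stabilizer is transitive on `∂𝒯`; (iii) `G` is
non-compact and transitive on `∂𝒯`; (iv) `G` is 2-transitive on `∂𝒯`. -/
theorem transitivity_characterizations
    {V : Type} (T : SimpleGraph V) (d : ℕ) (hd : 3 ≤ d)
    (hT : T.IsTree) (hreg : Regular T d)
    (G : Subgroup (T ≃g T)) (hclosed : IsClosed (G : Set (T ≃g T))) :
    ((∀ x : V, ∀ ξ η : GeodRay T, ∃ g ∈ G, g x = x ∧ RayEquiv T (mapRay T g ξ) η) ↔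
      (¬ IsCompact (G : Set (T ≃g T)) ∧
        ∃ x : V, ∀ ξ η : GeodRay T, ∃ g ∈ G, g x = x ∧ RayEquiv T (mapRay T g ξ) η)) ∧
    ((¬ IsCompact (G : Set (T ≃g T)) ∧
        ∃ x : V, ∀ ξ η : GeodRay T, ∃ g ∈ G, g x = x ∧ RayEquiv T (mapRay T g ξ) η) ↔
      (¬ IsCompact (G : Set (T ≃g T)) ∧
        ∀ ξ η : GeodRay T, ∃ g ∈ G, RayEquiv T (mapRay T g ξ) η)) ∧
    ((¬ IsCompact (G : Set (T ≃g T)) ∧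
        ∀ ξ η : GeodRay T, ∃ g ∈ G, RayEquiv T (mapRay T g ξ) η) ↔
      (∀ ξ₁ ξ₂ η₁ η₂ : GeodRay T, ¬ RayEquiv T ξ₁ ξ₂ → ¬ RayEquiv T η₁ η₂ →
        ∃ g ∈ G, RayEquiv T (mapRay T g ξ₁) η₁ ∧ RayEquiv T (mapRay T g ξ₂) η₂)) := by
  have h31 : (¬ IsCompact (G : Set (T ≃g T)) ∧
      ∀ ξ η : GeodRay T, ∃ g ∈ G, RayEquiv T (mapRay T g ξ) η) →
      ∀ x : V, ∀ ξ η : GeodRay T, ∃ g ∈ G, g x = x ∧ RayEquiv T (mapRay T g ξ) η :=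
    fun h => iii_i hT hd hreg hclosed h.1 h.2
  have h23 : (¬ IsCompact (G : Set (T ≃g T)) ∧
        ∃ x : V, ∀ ξ η : GeodRay T, ∃ g ∈ G, g x = x ∧ RayEquiv T (mapRay T g ξ) η) →
      (¬ IsCompact (G : Set (T ≃g T)) ∧
        ∀ ξ η : GeodRay T, ∃ g ∈ G, RayEquiv T (mapRay T g ξ) η) := by
    rintro ⟨h, x, hx⟩
    refine ⟨h, fun ξ η => ?_⟩
    obtain ⟨g, hg, _, e⟩ := hx ξ η
    exact ⟨g, hg, e⟩
  have h12 : (∀ x : V, ∀ ξ η : GeodRay T, ∃ g ∈ G, g x = x ∧ RayEquiv T (mapRay T g ξ) η) →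
      (¬ IsCompact (G : Set (T ≃g T)) ∧
        ∃ x : V, ∀ ξ η : GeodRay T, ∃ g ∈ G, g x = x ∧ RayEquiv T (mapRay T g ξ) η) :=
    fun h => ⟨i_nc hT hd hreg h, hT.connected.nonempty.some, h _⟩
  exact ⟨⟨h12, fun h => h31 (h23 h)⟩, ⟨h23, fun h => h12 (h31 h)⟩,
    ⟨fun h => i_iv hT hd hreg hclosed (h31 h),
      fun h => ⟨iv_nc hT hd hreg h, iv_tr hT hd hreg h⟩⟩⟩

end TreeHM
end

section
/- Let T be a locally finite tree and let G ≤ Aut(T) be a closed subgroup with Tits' independence property. Let ξ ∈ ∂T and suppose there is a vertex x of T such that G_ξ⁰ = {g ∈ G : g(ξ) = ξ and g fixes some vertex} is contained in the vertex stabilizer G_x. Then for any two edges e, e' lying on the geodesic ray [x, ξ) with dist(e, x) > 1 and dist(e', x) ≤ dist(e, x) − 1 (where dist(e, x) denotes the distance from x to the nearest endpoint of e), every element of G fixing the edge e also fixes the edge e', i.e. G_e ⊆ G_{e'}. -/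
open Filter Topology
open scoped InnerProductSpace

namespace TreeHM

variable {V : Type}

theorem geod_unique (T : SimpleGraph V) (hT : T.IsTree) {a b v w : V}
    (hv : T.dist a v + T.dist v b = T.dist a b)
    (h1 : T.dist a w = T.dist a v) (h2 : T.dist w b = T.dist v b) : w = v := by
  obtain ⟨p, hp⟩ := (hT.connected a v).exists_walk_length_eq_dist
  obtain ⟨q, hq⟩ := (hT.connected v b).exists_walk_length_eq_dist
  obtain ⟨p', hp'⟩ := (hT.connected a w).exists_walk_length_eq_dist
  obtain ⟨q', hq'⟩ := (hT.connected w b).exists_walk_length_eq_dist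
  have e1 : (p.append q).IsPath := SimpleGraph.Walk.isPath_of_length_eq_dist _ (by
    rw [SimpleGraph.Walk.length_append]; omega)
  have e2 : (p'.append q').IsPath := SimpleGraph.Walk.isPath_of_length_eq_dist _ (by
    rw [SimpleGraph.Walk.length_append]; omega)
  have e := (hT.existsUnique_path a b).unique e1 e2
  have h3 : (p.append q).getVert p.length = v := by
    simp [SimpleGraph.Walk.getVert_append]
  have h4 : (p'.append q').getVert p'.length = w := by
    simp [SimpleGraph.Walk.getVert_append]
  rw [← h3, ← h4, e, hp, hp', h1]

/-- Let `G ≤ Aut(T)` be closed with Tits' independence property,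
`ξ ∈ ∂T` and `x` a vertex with `G_ξ⁰ ⊆ G_x`.  Then for edges `e, e'` on the ray `[x, ξ)`
with `dist(e, x) > 1` and `dist(e', x) ≤ dist(e, x) − 1`, every element of `G` fixing `e`
pointwise also fixes `e'` pointwise. -/
theorem edge_fixator_monotone_along_ray
    {V : Type} (T : SimpleGraph V) (hT : T.IsTree) (hlf : LocFin T)
    (G : Subgroup (T ≃g T)) (hclosed : IsClosed (G : Set (T ≃g T)))
    (htits : TitsIndep T G)
    (ξ : GeodRay T) (x : V) (hbase : ξ.seq 0 = x)
    (hsub : EndStab0 T G ξ ⊆ {g : G | (g : T ≃g T) x = x}) :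
    ∀ i j : ℕ, 1 < i → j ≤ i - 1 →
      ∀ g ∈ G, g (ξ.seq i) = ξ.seq i → g (ξ.seq (i + 1)) = ξ.seq (i + 1) →
        g (ξ.seq j) = ξ.seq j ∧ g (ξ.seq (j + 1)) = ξ.seq (j + 1) := by
  intro i j hi hj g hg ha hb
  obtain ⟨g₁, hg₁, g₂, hg₂, rfl, hs₁, hs₂⟩ := htits _ _ (ξ.adj i) g hg ha hb
  have hr : ∀ n, i + 1 ≤ n → g₂ (ξ.seq n) = ξ.seq n := by
    intro n hn
    apply hs₂
    simp only [EdgeSide, Set.mem_setOf_eq, ξ.geodesic, Nat.dist]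
    omega
  have hl : ∀ n, n ≤ i → g₁ (ξ.seq n) = ξ.seq n := by
    intro n hn
    apply hs₁
    simp only [EdgeSide, Set.mem_setOf_eq, ξ.geodesic, Nat.dist]
    omega
  have hx : g₂ (ξ.seq 0) = ξ.seq 0 := by
    have hm : (⟨g₂, hg₂⟩ : G) ∈ EndStab0 T G ξ :=
      ⟨⟨i + 1, i + 1, fun n => hr _ (by omega)⟩, ⟨_, hr (i + 1) le_rfl⟩⟩
    have := hsub hm
    rw [hbase]
    exact this
  have hf : ∀ n, n ≤ i → g₂ (ξ.seq n) = ξ.seq n := by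
    intro n hn
    apply geod_unique T hT (a := ξ.seq 0) (b := ξ.seq (i + 1))
    · simp only [ξ.geodesic, Nat.dist]
      omega
    · conv_lhs => rw [← hx]
      exact iso_dist_eq T g₂ _ _
    · conv_lhs => rw [← hr (i + 1) le_rfl]
      exact iso_dist_eq T g₂ _ _
  have key : ∀ n, n ≤ i → (g₁ * g₂) (ξ.seq n) = ξ.seq n := by
    intro n hn
    rw [RelIso.mul_apply, hf n hn, hl n hn]
  exact ⟨key j (by omega), key (j + 1) (by omega)⟩

end TreeHM
end

section
/- Let T be a locally finite tree and let α = (g_n) be a sequence in Aut(T). Assume there exist a vertex x ∈ T and an end ξ ∈ ∂T such that g_n(x) → ξ as n → ∞. Then every element g of the contraction group U⁺_α = {g ∈ Aut(T) : g_n⁻¹ g g_n → e} fixes the end ξ, and fixes the vertex g_n(x) for all sufficiently large n; in particular U⁺_α ⊆ {g ∈ Aut(T) : g(ξ) = ξ and g fixes some vertex of T}. -/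
open Filter Topology
open scoped InnerProductSpace

namespace TreeHM

variable {V : Type}

theorem fix_on_path (T : SimpleGraph V) (hT : T.IsTree) (g : T ≃g T) {p y : V}
    (hp : g p = p) (hy : g y = y) (P : T.Walk p y) (hP : P.IsPath) (z : V)
    (hz : z ∈ P.support) : g z = z := by
  obtain ⟨i, hi, -⟩ := SimpleGraph.Walk.mem_support_iff_exists_getVert.mp hz
  have hQ : ((P.map g.toHom).copy hp hy).IsPath := by
    simpa using SimpleGraph.Walk.map_isPath_of_injective g.injective hP
  have h : (P.map g.toHom).copy hp hy = P :=
    congrArg Subtype.val (hT.isAcyclic.path_unique ⟨_, hQ⟩ ⟨_, hP⟩)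
  have h2 := congrArg (fun w => SimpleGraph.Walk.getVert w i) h
  simp only [SimpleGraph.Walk.getVert_copy, SimpleGraph.Walk.getVert_map] at h2
  rw [hi] at h2
  exact h2

theorem between_mem (T : SimpleGraph V) (hT : T.IsTree) {a b y : V}
    (h : T.dist a y = T.dist a b + T.dist b y) (W : T.Walk a y) : b ∈ W.support := by
  classical
  obtain ⟨p, hp⟩ := hT.connected.exists_walk_length_eq_dist a b
  obtain ⟨q, hq⟩ := hT.connected.exists_walk_length_eq_dist b y
  have hpath : (p.append q).IsPath := by
    apply SimpleGraph.Walk.isPath_of_length_eq_dist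
    rw [SimpleGraph.Walk.length_append, hp, hq, h]
  have he : p.append q = W.bypass :=
    congrArg Subtype.val (hT.isAcyclic.path_unique ⟨_, hpath⟩ ⟨_, W.bypass_isPath⟩)
  apply W.support_bypass_subset
  rw [← he, SimpleGraph.Walk.mem_support_append_iff]
  exact Or.inl p.end_mem_support

theorem eventually_fix (T : SimpleGraph V) (α : ℕ → (T ≃g T)) (x : V) (g : T ≃g T)
    (hg : g ∈ ContrSeq α) : ∀ᶠ n in atTop, g ((α n) x) = (α n) x := by
  letI : TopologicalSpace V := ⊥
  haveI : DiscreteTopology V := ⟨rfl⟩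
  have hc : Continuous (fun (h : T ≃g T) (v : V) => h v) := continuous_induced_dom
  have hc' : Continuous (fun h : T ≃g T => h x) := (continuous_apply x).comp hc
  have ht := (hc'.tendsto 1).comp hg
  rw [nhds_discrete, tendsto_pure] at ht
  filter_upwards [ht] with n hn
  have h1 : (α n).symm (g (α n x)) = x := hn
  rw [← (α n).apply_symm_apply (g (α n x)), h1]

/-- Let `T` be a locally finite tree and `α = (g_n)` a sequence in
`Aut(T)` with `g_n(x) → ξ`.  Then every `g ∈ U⁺_α` fixes the end `ξ` and fixes the vertex
`g_n(x)` for all sufficiently large `n`; in particular it fixes some vertex of `T`. -/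
theorem contraction_fixes_end
    {V : Type} (T : SimpleGraph V) (hT : T.IsTree) (hlf : LocFin T)
    (α : ℕ → (T ≃g T)) (x : V) (ξ : GeodRay T)
    (hconv : TendstoEnd T (fun n : ℕ => (α n) x) ξ) :
    ∀ g ∈ ContrSeq α, FixesEnd T g ξ ∧
      (∀ᶠ n in atTop, g ((α n) x) = (α n) x) ∧ ∃ y : V, g y = y := by
  intro g hg
  have hev := eventually_fix T α x g hg
  obtain ⟨N, hN⟩ := hev.exists
  refine ⟨?_, hev, _, hN⟩
  obtain ⟨A, hA⟩ := hT.connected.exists_walk_length_eq_dist (ξ.seq 0) (α N x)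
  have key : ∀ m, A.length < m → g (ξ.seq m) = ξ.seq m := by
    intro m hm
    obtain ⟨n, hn, hd⟩ := (hev.and (hconv m)).exists
    obtain ⟨P, hP⟩ := hT.connected.exists_walk_length_eq_dist (α N x) (α n x)
    have h0 : T.dist (ξ.seq 0) (ξ.seq m) = m := by
      rw [ξ.geodesic]; simp [Nat.dist]
    have hmem := between_mem T hT (b := ξ.seq m) (by rw [h0]; exact hd) (A.append P)
    rw [SimpleGraph.Walk.mem_support_append_iff] at hmem
    rcases hmem with hmem | hmem
    · exfalso
      obtain ⟨q, r, rfl⟩ := SimpleGraph.Walk.mem_support_iff_exists_append.mp hmem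
      have := SimpleGraph.dist_le q
      rw [SimpleGraph.Walk.length_append] at hm
      omega
    · exact fix_on_path T hT g hN hn P
        (SimpleGraph.Walk.isPath_of_length_eq_dist _ hP) _ hmem
  exact ⟨A.length + 1, A.length + 1, fun n => key _ (by omega)⟩

end TreeHM
end
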